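/- Let G₁₆′ be the 6-regular simple graph on vertex set {0,1,...,9} with edges given by the adjacency lists: 0 ~ 1,2,3,6,8,9; 1 ~ 0,2,3,4,5,8; 2 ~ 0,1,3,5,7,8; 3 ~ 0,1,2,4,6,9; 4 ~ 1,3,5,6,7,9; 5 ~ 1,2,4,6,7,9; 6 ~ 0,3,4,5,7,8; 7 ~ 2,4,5,6,8,9; 8 ~ 0,1,2,6,7,9; 9 ~ 0,3,4,5,7,8. Then the sum of sign(𝓕) over all ordered 1-factorizations 𝓕 of G₁₆′ is nonzero. -/

import Mathlib

open scoped Classical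

/-- Two edges `e = {a,c}` and `f = {b,d}` (with `a < c`, `b < d`) of a graph on
`{0, …, m-1}` *cross* (intersect) if `a < b < c < d`.  For an unordered pair of
distinct matching edges that intersect in the sense of Schauz, exactly one of
`crosses e f`, `crosses f e` holds. -/
def crosses {m : ℕ} (e f : Sym2 (Fin m)) : Prop :=
  ∃ a b c d : Fin m, e = s(a, c) ∧ f = s(b, d) ∧ a < b ∧ b < c ∧ c < d

/-- `sign F = (-1)^{int F}` where `int F` is the number of unordered pairs of
intersecting edges of `F`. -/
noncomputable def matchingSign {m : ℕ} (F : Finset (Sym2 (Fin m))) : ℤ :=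
  (-1) ^ (Finset.filter (fun p : Sym2 (Fin m) × Sym2 (Fin m) => crosses p.1 p.2)
      (F ×ˢ F)).card

/-- `F` is (the edge set of) a perfect matching of `G`: every edge of `F` is an
edge of `G` and every vertex lies in exactly one edge of `F`. -/
def IsPerfectMatchingOf {m : ℕ} (G : SimpleGraph (Fin m))
    (F : Finset (Sym2 (Fin m))) : Prop :=
  (∀ e ∈ F, e ∈ G.edgeSet) ∧ ∀ v : Fin m, ∃! e, e ∈ F ∧ v ∈ e

/-- An ordered 1-factorization `𝓕 = (F_1, …, F_k)` of `G`: each `F_i` is a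
perfect matching of `G`, and the `F_i` partition the edge set of `G`. -/
def IsOrderedOneFactorization {m k : ℕ} (G : SimpleGraph (Fin m))
    (𝓕 : Fin k → Finset (Sym2 (Fin m))) : Prop :=
  (∀ i, IsPerfectMatchingOf G (𝓕 i)) ∧ ∀ e, e ∈ G.edgeSet ↔ ∃! i, e ∈ 𝓕 i

/-- The sum of `sign 𝓕 = sign (F_1) ⋯ sign (F_k)` over all ordered
1-factorizations `𝓕` of `G`. -/
noncomputable def factorizationSignSum {m : ℕ} (k : ℕ) (G : SimpleGraph (Fin m)) : ℤ :=
  ∑ 𝓕 ∈ Finset.filter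
      (fun 𝓕 : Fin k → Finset (Sym2 (Fin m)) => IsOrderedOneFactorization G 𝓕)
      Finset.univ,
    ∏ i : Fin k, matchingSign (𝓕 i)

/-- The 6-regular graph `G16'` on `{0, …, 9}`. -/
def G16' : SimpleGraph (Fin 10) :=
  SimpleGraph.fromEdgeSet
    {s(0, 1), s(0, 2), s(0, 3), s(0, 6), s(0, 8), s(0, 9), s(1, 2), s(1, 3), s(1, 4), s(1, 5), s(1, 8), s(2, 3), s(2, 5), s(2, 7), s(2, 8), s(3, 4), s(3, 6), s(3, 9), s(4, 5), s(4, 6), s(4, 7), s(4, 9), s(5, 6), s(5, 7), s(5, 9), s(6, 7), s(6, 8), s(7, 8), s(7, 9), s(8, 9)}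

/-! ### Ordered partitions of a finite set, weighted by a product over the blocks -/

section OrderedPartition

variable {α : Type*} [DecidableEq α]

/-- The blocks `𝓕 0, …, 𝓕 (k-1)` are pairwise disjoint with union `S`. -/
def IsOrderedPartition {k : ℕ} (S : Finset α) (𝓕 : Fin k → Finset α) : Prop :=
  ∀ e, (Finset.univ.filter fun i => e ∈ 𝓕 i).card = if e ∈ S then 1 else 0

/-- The sum of `∏ i, w (𝓕 i)` over all ordered partitions `𝓕` of `S` into `k` blocks. -/
noncomputable def partitionSum [Fintype α] (w : Finset α → ℤ) (k : ℕ) (S : Finset α) : ℤ :=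
  ∑ 𝓕 : Fin k → Finset α, if IsOrderedPartition S 𝓕 then ∏ i, w (𝓕 i) else 0

theorem isOrderedPartition_cons {k : ℕ} (S M : Finset α) (𝓕 : Fin k → Finset α) :
    IsOrderedPartition S (Fin.cons M 𝓕 : Fin (k + 1) → Finset α) ↔
      M ⊆ S ∧ IsOrderedPartition (S \ M) 𝓕 := by
  simp only [IsOrderedPartition, Fin.card_filter_univ_succ, Fin.cons_zero, Fin.cons_succ,
    Finset.subset_iff, ← forall_and, Finset.mem_sdiff]
  refine forall_congr' fun e => ?_
  by_cases h₁ : e ∈ M <;> by_cases h₂ : e ∈ S <;> simp [h₁, h₂]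

theorem isOrderedPartition_comp {k : ℕ} (S : Finset α) (𝓕 : Fin k → Finset α)
    (σ : Equiv.Perm (Fin k)) :
    IsOrderedPartition S (𝓕 ∘ σ) ↔ IsOrderedPartition S 𝓕 := by
  refine forall_congr' fun e => ?_
  rw [Finset.card_equiv σ (t := Finset.univ.filter fun i => e ∈ 𝓕 i) (by simp)]

theorem partitionSum_zero [Fintype α] (w : Finset α → ℤ) (S : Finset α) :
    partitionSum w 0 S = if S = ∅ then 1 else 0 := by
  simp [partitionSum, IsOrderedPartition, Finset.eq_empty_iff_forall_notMem]

/-- The sum over ordered partitions, expanded along the block that contains `e`. -/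
theorem partitionSum_succ [Fintype α] (w : Finset α → ℤ) (k : ℕ) {S : Finset α} {e : α}
    (he : e ∈ S) :
    partitionSum w (k + 1) S =
      (k + 1) * ∑ M, if e ∈ M ∧ M ⊆ S then w M * partitionSum w k (S \ M) else 0 := by
  let f (i : Fin (k + 1)) (𝓕 : Fin (k + 1) → Finset α) : ℤ :=
    if IsOrderedPartition S 𝓕 ∧ e ∈ 𝓕 i then ∏ i, w (𝓕 i) else 0
  have hsplit : partitionSum w (k + 1) S = ∑ i, ∑ 𝓕, f i 𝓕 := by
    rw [Finset.sum_comm]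
    refine Finset.sum_congr rfl fun 𝓕 _ => ?_
    by_cases h : IsOrderedPartition S 𝓕
    · have := h e
      simp only [he, if_true] at this
      simp [f, h, ← Finset.sum_filter, this]
    · simp [f, h]
  have hswap (i : Fin (k + 1)) : ∑ 𝓕, f i 𝓕 = ∑ 𝓕, f 0 𝓕 := by
    refine Fintype.sum_equiv (Equiv.arrowCongr (Equiv.swap 0 i) (Equiv.refl _)) _ _ fun 𝓕 => ?_
    have hcomp : Equiv.arrowCongr (Equiv.swap 0 i) (Equiv.refl _) 𝓕 = 𝓕 ∘ Equiv.swap 0 i := by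
      ext; simp [Equiv.arrowCongr]
    simp only [f, hcomp, isOrderedPartition_comp, Function.comp_apply, Equiv.swap_apply_left]
    rw [Equiv.prod_comp (Equiv.swap 0 i) fun j => w (𝓕 j)]
  rw [hsplit, Finset.sum_congr rfl fun i _ => hswap i, Finset.sum_const, Finset.card_univ,
    Fintype.card_fin, nsmul_eq_mul, ← (Fin.consEquiv fun _ => Finset α).sum_comp,
    Fintype.sum_prod_type]
  push_cast
  congr 1
  refine Finset.sum_congr rfl fun M _ => ?_
  by_cases h : e ∈ M ∧ M ⊆ S
  · simp [f, partitionSum, Fin.consEquiv, isOrderedPartition_cons, h, Fin.prod_univ_succ,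
      Finset.mul_sum]
  · rw [if_neg h]
    refine Finset.sum_eq_zero fun 𝓕 _ => if_neg ?_
    simp only [Fin.consEquiv, Equiv.coe_fn_mk, isOrderedPartition_cons, Fin.cons_zero]
    tauto

end OrderedPartition

/-! ### Perfect matchings -/

section Matching

variable {m : ℕ}

/-- The weight of `F` is its sign if `F` is a perfect matching of `G`, and `0` otherwise. -/
noncomputable def matchingWeight (G : SimpleGraph (Fin m)) (F : Finset (Sym2 (Fin m))) : ℤ :=
  if IsPerfectMatchingOf G F then matchingSign F else 0

theorem factorizationSignSum_eq_partitionSum (k : ℕ) (G : SimpleGraph (Fin m))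
    (S : Finset (Sym2 (Fin m))) (hS : ∀ e, e ∈ G.edgeSet ↔ e ∈ S) :
    factorizationSignSum k G = partitionSum (matchingWeight G) k S := by
  rw [factorizationSignSum, partitionSum, Finset.sum_filter]
  refine Finset.sum_congr rfl fun 𝓕 _ => ?_
  by_cases h : ∀ i, IsPerfectMatchingOf G (𝓕 i)
  · have : IsOrderedOneFactorization G 𝓕 ↔ IsOrderedPartition S 𝓕 := by
      simp only [IsOrderedOneFactorization, h, implies_true, true_and, IsOrderedPartition]
      refine forall_congr' fun e => ?_
      rw [hS]
      by_cases he : e ∈ S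
      · simp only [he, true_iff, if_true, Finset.card_eq_one, Finset.eq_singleton_iff_unique_mem,
          Finset.mem_filter, Finset.mem_univ, true_and, ExistsUnique]
      · have hn : ∀ i, e ∉ 𝓕 i := fun i hi => he ((hS e).1 ((h i).1 e hi))
        simp [he, hn]
    simp [this, matchingWeight, h]
  · obtain ⟨i, hi⟩ := not_forall.1 h
    rw [if_neg fun hF => h hF.1, Finset.prod_eq_zero (Finset.mem_univ i) (if_neg hi), ite_self]

theorem mk_inf_sup (e : Sym2 (Fin m)) : s(e.inf, e.sup) = e :=
  Sym2.sortEquiv.symm_apply_apply e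

theorem crosses_iff (e f : Sym2 (Fin m)) :
    crosses e f ↔ e.inf < f.inf ∧ f.inf < e.sup ∧ e.sup < f.sup := by
  constructor
  · rintro ⟨a, b, c, d, rfl, rfl, hab, hbc, hcd⟩
    have h₁ := hab.trans hbc
    have h₂ := hbc.trans hcd
    simp [h₁.le, h₂.le, hab, hbc, hcd]
  · rintro ⟨h₁, h₂, h₃⟩
    exact ⟨e.inf, f.inf, e.sup, f.sup, (mk_inf_sup e).symm, (mk_inf_sup f).symm, h₁, h₂, h₃⟩

theorem isPerfectMatchingOf_iff {G : SimpleGraph (Fin m)} {S : Finset (Sym2 (Fin m))}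
    (hS : ∀ e, e ∈ G.edgeSet ↔ e ∈ S) (F : Finset (Sym2 (Fin m))) :
    IsPerfectMatchingOf G F ↔ F ⊆ S ∧ ∀ v, (F.filter fun e => v ∈ e).card = 1 := by
  simp only [IsPerfectMatchingOf, hS, Finset.subset_iff, Finset.card_eq_one,
    Finset.eq_singleton_iff_unique_mem, Finset.mem_filter, ExistsUnique]

/-- The set of edges listed in `l`. -/
def edgesOf (l : List (Fin m × Fin m)) : Finset (Sym2 (Fin m)) :=
  (l.map fun p => s(p.1, p.2)).toFinset

/-- The matchings with edges in `S` that cover exactly the vertices in the given list, which has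
at most `2 * n` entries. -/
def matchingsOn (S : Finset (Sym2 (Fin m))) : ℕ → List (Fin m) → List (List (Fin m × Fin m))
  | _, [] => [[]]
  | 0, _ :: _ => []
  | n + 1, v :: vs =>
    (vs.filter fun u => s(v, u) ∈ S).flatMap fun u =>
      (matchingsOn S n (vs.erase u)).map ((v, u) :: ·)

theorem exists_mem_matchingsOn {S : Finset (Sym2 (Fin m))} (hS : ∀ e ∈ S, ¬ e.IsDiag) (n : ℕ) :
    ∀ (U : List (Fin m)) (F : Finset (Sym2 (Fin m))), U.Nodup → U.length ≤ 2 * n → F ⊆ S →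
      (∀ e ∈ F, ∀ v ∈ e, v ∈ U) → (∀ v ∈ U, ∃! e, e ∈ F ∧ v ∈ e) →
      ∃ l ∈ matchingsOn S n U, edgesOf l = F := by
  have hnil (n : ℕ) (F : Finset (Sym2 (Fin m))) (hF : ∀ e ∈ F, ∀ v ∈ e, v ∈ ([] : List (Fin m))) :
      ∃ l ∈ matchingsOn S n [], edgesOf l = F := by
    refine ⟨[], by simp [matchingsOn], (Finset.eq_empty_of_forall_notMem fun e he => ?_).symm⟩
    induction e with | _ a b => simpa using hF _ he a (by simp)
  induction n with
  | zero =>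
    intro U F _ hlen _ hU _
    obtain rfl : U = [] := List.length_eq_zero_iff.1 (by omega)
    exact hnil 0 F hU
  | succ n ih =>
    rintro (_ | ⟨v, vs⟩) F hnd hlen hFS hU hex
    · exact hnil _ F hU
    obtain ⟨hv, hvs⟩ := List.nodup_cons.1 hnd
    obtain ⟨e, ⟨heF, hve⟩, huniq⟩ := hex v (by simp)
    obtain ⟨u, rfl⟩ := hve
    have huv : u ≠ v := by
      rintro rfl
      exact hS _ (hFS heF) (by simp)
    have hu : u ∈ vs := by
      have := hU _ heF u (by simp)
      simpa [huv] using this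
    have huniq' : ∀ e ∈ F, u ∈ e → e = s(v, u) := fun e he hue =>
      (hex u (by simp [hu])).unique ⟨he, hue⟩ ⟨heF, by simp⟩
    obtain ⟨l, hl, hlF⟩ := ih (vs.erase u) (F.erase s(v, u)) (hvs.erase u)
      (by rw [List.length_erase_of_mem hu]; simp at hlen; omega)
      ((Finset.erase_subset _ _).trans hFS)
      (by
        intro e he x hx
        obtain ⟨hne, heF'⟩ := Finset.mem_erase.1 he
        have hxv : x ≠ v := by rintro rfl; exact hne (huniq e ⟨heF', hx⟩)
        have hxu : x ≠ u := by rintro rfl; exact hne (huniq' e heF' hx)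
        have := hU e heF' x hx
        simp only [List.mem_cons, hxv, false_or] at this
        exact (hvs.mem_erase_iff).2 ⟨hxu, this⟩)
      (by
        intro x hx
        obtain ⟨hxu, hx⟩ := hvs.mem_erase_iff.1 hx
        have hxv : x ≠ v := by rintro rfl; exact hv hx
        obtain ⟨e, ⟨he, hxe⟩, hunq⟩ := hex x (by simp [hx])
        refine ⟨e, ⟨Finset.mem_erase.2 ⟨?_, he⟩, hxe⟩, fun e' he' =>
          hunq e' ⟨Finset.mem_of_mem_erase he'.1, he'.2⟩⟩
        rintro rfl
        simp [hxu, hxv] at hxe)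
    refine ⟨(v, u) :: l, ?_, ?_⟩
    · simp only [matchingsOn, List.mem_flatMap, List.mem_filter, List.mem_map]
      exact ⟨u, ⟨hu, by simpa using hFS heF⟩, l, hl, rfl⟩
    · have : edgesOf ((v, u) :: l) = insert s(v, u) (edgesOf l) := by simp [edgesOf]
      rw [this, hlF, Finset.insert_erase heF]

/-- The sign of the matching listed in `l`. -/
def listSign (l : List (Fin m × Fin m)) : ℤ :=
  (-1) ^ ((edgesOf l ×ˢ edgesOf l).filter fun p : Sym2 (Fin m) × Sym2 (Fin m) =>
    p.1.inf < p.2.inf ∧ p.2.inf < p.1.sup ∧ p.1.sup < p.2.sup).card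

theorem matchingSign_edgesOf (l : List (Fin m × Fin m)) :
    matchingSign (edgesOf l) = listSign l := by
  simp only [matchingSign, listSign, crosses_iff]

end Matching

/-! ### Bit masks -/

section Mask

variable {m : ℕ}

/-- A number that determines the edge. -/
def edgeCode (e : Sym2 (Fin m)) : ℕ := m * e.inf + e.sup

theorem edgeCode_injective : Function.Injective (edgeCode (m := m)) := by
  intro e f h
  have hm : 0 < m := e.inf.pos
  have h₁ : (e.inf : ℕ) = f.inf := by
    have := congrArg (· / m) h
    simpa [edgeCode, Nat.mul_add_div hm, Nat.div_eq_of_lt] using this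
  have h₂ : (e.sup : ℕ) = f.sup := by
    simpa [edgeCode, h₁] using h
  rw [← mk_inf_sup e, ← mk_inf_sup f, Fin.ext h₁, Fin.ext h₂]

/-- The set of edges encoded by the bits of `b`. -/
def maskEdges (b : ℕ) : Finset (Sym2 (Fin m)) :=
  Finset.univ.filter fun e => b.testBit (edgeCode e)

/-- The bit mask that encodes the edges in `l`. -/
def maskOf (l : List (Fin m × Fin m)) : ℕ :=
  l.foldr (fun p b => 1 <<< edgeCode s(p.1, p.2) ||| b) 0

theorem testBit_maskOf (l : List (Fin m × Fin m)) (i : ℕ) :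
    (maskOf l).testBit i ↔ ∃ e ∈ edgesOf l, edgeCode e = i := by
  induction l with
  | nil => simp [maskOf, edgesOf]
  | cons p l ih =>
    have h₁ : edgesOf (p :: l) = insert s(p.1, p.2) (edgesOf l) := by simp [edgesOf]
    have h₂ : maskOf (p :: l) = 1 <<< edgeCode s(p.1, p.2) ||| maskOf l := rfl
    rw [h₁, h₂, Nat.testBit_or, Bool.or_eq_true, ih, Nat.one_shiftLeft, Nat.testBit_two_pow]
    simp

theorem maskEdges_maskOf (l : List (Fin m × Fin m)) : maskEdges (maskOf l) = edgesOf l := by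
  ext e
  simp [maskEdges, testBit_maskOf, edgeCode_injective.eq_iff]

theorem maskEdges_xor_maskOf (b : ℕ) (l : List (Fin m × Fin m)) (h : edgesOf l ⊆ maskEdges b) :
    maskEdges (b ^^^ maskOf l) = maskEdges b \ edgesOf l := by
  rw [← maskEdges_maskOf] at h ⊢
  ext e
  have := @h e
  simp only [maskEdges, Finset.mem_filter, Finset.mem_univ, true_and, Nat.testBit_xor,
    Finset.mem_sdiff] at this ⊢
  revert this
  cases b.testBit (edgeCode e) <;> cases (maskOf l).testBit (edgeCode e) <;> simp

theorem maskOf_land_eq_iff (b : ℕ) (l : List (Fin m × Fin m)) :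
    maskOf l &&& b = maskOf l ↔ edgesOf l ⊆ maskEdges b := by
  constructor
  · intro h e he
    have h₁ : (maskOf l).testBit (edgeCode e) := (testBit_maskOf l _).2 ⟨e, he, rfl⟩
    rw [← h, Nat.testBit_and, Bool.and_eq_true] at h₁
    simpa [maskEdges] using h₁.2
  · intro h
    refine Nat.eq_of_testBit_eq fun i => ?_
    rw [Nat.testBit_and]
    cases hi : (maskOf l).testBit i
    · rfl
    · obtain ⟨e, he, rfl⟩ := (testBit_maskOf l i).1 hi
      simpa [maskEdges] using h he

theorem maskOf_eq_of_edgesOf_eq {l l' : List (Fin m × Fin m)} (h : edgesOf l = edgesOf l') :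
    maskOf l = maskOf l' :=
  Nat.eq_of_testBit_eq fun i => by rw [Bool.eq_iff_iff, testBit_maskOf, testBit_maskOf, h]

/-- The sum of the products of weights over all ways to split the nonzero mask `b` into one mask
from each of the given lists. Matching on `b + 1` makes the kernel evaluate the mask to a literal
before it is compared with the members of the list. -/
def splitSum : List (List (ℕ × ℤ)) → ℕ → ℤ
  | [], b => if b = 0 then 1 else 0
  | _ :: _, 0 => 0
  | L :: Ls, b + 1 =>
    (L.map fun p => if p.1 &&& (b + 1) = p.1 then p.2 * splitSum Ls ((b + 1) ^^^ p.1) else 0).sum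

theorem splitSum_cons (L : List (ℕ × ℤ)) (Ls : List (List (ℕ × ℤ))) {b : ℕ} (hb : b ≠ 0) :
    splitSum (L :: Ls) b =
      (L.map fun p => if p.1 &&& b = p.1 then p.2 * splitSum Ls (b ^^^ p.1) else 0).sum := by
  cases b with
  | zero => exact absurd rfl hb
  | succ b => rfl

/-- The members of `L` that contain the edge `e`, as masks weighted by sign. -/
def weightedMasks (L : List (List (Fin m × Fin m))) (e : Sym2 (Fin m)) : List (ℕ × ℤ) :=
  (L.filter fun l => e ∈ edgesOf l).map fun l => (maskOf l, listSign l)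

theorem partitionSum_maskEdges {G : SimpleGraph (Fin m)} {L : List (List (Fin m × Fin m))}
    (hnd : (L.map maskOf).Nodup) (hL : ∀ F, IsPerfectMatchingOf G F ↔ ∃ l ∈ L, edgesOf l = F)
    (v : Fin m) (es : List (Sym2 (Fin m))) :
    ∀ b : ℕ, es.Nodup → (∀ e ∈ es, v ∈ e) → (∀ e ∈ es, e ∈ maskEdges b) →
      (∀ i, b.testBit i → ∃ e : Sym2 (Fin m), edgeCode e = i) →
      partitionSum (matchingWeight G) es.length (maskEdges b) =
        es.length.factorial * splitSum (es.map (weightedMasks L)) b := by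
  have hw (l) (hl : l ∈ L) : matchingWeight G (edgesOf l) = listSign l := by
    rw [matchingWeight, if_pos ((hL _).2 ⟨l, hl, rfl⟩), matchingSign_edgesOf]
  have hnd' : (L.map edgesOf).Nodup := by
    rw [List.Nodup, List.pairwise_map] at hnd ⊢
    exact hnd.imp fun h h' => h (maskOf_eq_of_edgesOf_eq h')
  induction es with
  | nil =>
    intro b _ _ _ hb
    have : (maskEdges b : Finset (Sym2 (Fin m))) = ∅ ↔ b = 0 := by
      refine ⟨fun h => Nat.eq_of_testBit_eq fun i => ?_, ?_⟩
      · rw [Nat.zero_testBit, Bool.eq_false_iff]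
        intro hi
        obtain ⟨e, rfl⟩ := hb i hi
        have : e ∈ (maskEdges b : Finset (Sym2 (Fin m))) := by simpa [maskEdges] using hi
        simp [h] at this
      · rintro rfl
        simp [maskEdges]
    simp [partitionSum_zero, splitSum, this]
  | cons e es ih =>
    intro b hes hv hmem hb
    have hb₀ : b ≠ 0 := by
      rintro rfl
      simpa [maskEdges] using hmem e (by simp)
    obtain ⟨hees, hes⟩ := List.nodup_cons.1 hes
    set g : Finset (Sym2 (Fin m)) → ℤ := fun M =>
      if e ∈ M ∧ M ⊆ maskEdges b then
        matchingWeight G M * partitionSum (matchingWeight G) es.length (maskEdges b \ M) else 0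
      with hg
    have hsum : ∑ M, g M = (L.map fun l => g (edgesOf l)).sum := by
      rw [← Function.comp_def g edgesOf, ← List.map_map, ← List.sum_toFinset _ hnd']
      symm
      refine Finset.sum_subset (Finset.subset_univ _) fun M _ hM => ?_
      have : matchingWeight G M = 0 := if_neg fun h => hM (by simpa using (hL M).1 h)
      simp [this]
    have hstep : ∀ l ∈ L, g (edgesOf l) = es.length.factorial *
        (if e ∈ edgesOf l then if maskOf l &&& b = maskOf l then
          listSign l * splitSum (es.map (weightedMasks L)) (b ^^^ maskOf l) else 0 else 0) := by
      intro l hl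
      by_cases he : e ∈ edgesOf l <;> by_cases hsub : edgesOf l ⊆ maskEdges b <;>
        simp only [hg, he, hsub, maskOf_land_eq_iff, and_true, and_false, if_true,
          if_false, mul_zero]
      rw [hw l hl, ← maskEdges_xor_maskOf _ _ hsub, ih _ hes fun e he => hv e (by simp [he])]
      · ring
      · intro e' he'
        rw [maskEdges_xor_maskOf _ _ hsub]
        refine Finset.mem_sdiff.2 ⟨hmem e' (by simp [he']), fun hel => hees ?_⟩
        have hpm := (hL _).2 ⟨l, hl, rfl⟩
        rwa [(hpm.2 v).unique ⟨he, hv e (by simp)⟩ ⟨hel, hv e' (by simp [he'])⟩]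
      · intro i hi
        by_cases hbi : b.testBit i
        · exact hb i hbi
        · simp only [Nat.testBit_xor, hbi, Bool.false_bne] at hi
          obtain ⟨e, -, he⟩ := (testBit_maskOf l i).1 hi
          exact ⟨e, he⟩
    have hfilter (f : List (Fin m × Fin m) → ℤ) :
        (L.map fun l => if e ∈ edgesOf l then f l else 0).sum =
          ((L.filter fun l => e ∈ edgesOf l).map f).sum := by
      rw [List.sum_map_ite]
      simp
    rw [List.length_cons, partitionSum_succ _ _ (hmem e (by simp)), hsum,
      List.map_congr_left hstep, List.sum_map_mul_left, hfilter, List.map_cons,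
      splitSum_cons _ _ hb₀, weightedMasks, List.map_map, Nat.factorial_succ]
    push_cast
    simp only [Function.comp_def]
    ring

end Mask

/-! ### The six-regular graph on ten vertices -/

/-- The edges of the graph. -/
def g16Edges : List (Fin 10 × Fin 10) :=
  [(0, 1), (0, 2), (0, 3), (0, 6), (0, 8), (0, 9), (1, 2), (1, 3), (1, 4), (1, 5), (1, 8), (2, 3),
    (2, 5), (2, 7), (2, 8), (3, 4), (3, 6), (3, 9), (4, 5), (4, 6), (4, 7), (4, 9), (5, 6), (5, 7),
    (5, 9), (6, 7), (6, 8), (7, 8), (7, 9), (8, 9)]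

/-- The perfect matchings of the graph, as lists of edges. -/
def g16Matchings : List (List (Fin 10 × Fin 10)) :=
  matchingsOn (edgesOf g16Edges) 5 (List.finRange 10)

theorem not_isDiag_of_mem_edgesOf_g16Edges :
    ∀ e ∈ edgesOf g16Edges, ¬ e.IsDiag := by
  decide +kernel

theorem mem_edgeSet_g16_iff (e : Sym2 (Fin 10)) :
    e ∈ G16'.edgeSet ↔ e ∈ edgesOf g16Edges := by
  have h : e ∈ G16'.edgeSet ↔ e ∈ edgesOf g16Edges ∧ ¬ e.IsDiag := by
    simp [G16', SimpleGraph.edgeSet_fromEdgeSet, edgesOf, g16Edges]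
  rw [h]
  exact and_iff_left_of_imp (not_isDiag_of_mem_edgesOf_g16Edges e)

theorem edgesOf_mem_g16Matchings :
    ∀ l ∈ g16Matchings, edgesOf l ⊆ edgesOf g16Edges ∧
      ∀ v, ((edgesOf l).filter fun e => v ∈ e).card = 1 := by
  decide +kernel

theorem isPerfectMatchingOf_g16_iff (F : Finset (Sym2 (Fin 10))) :
    IsPerfectMatchingOf G16' F ↔ ∃ l ∈ g16Matchings, edgesOf l = F := by
  constructor
  · rintro ⟨hF, hv⟩
    exact exists_mem_matchingsOn not_isDiag_of_mem_edgesOf_g16Edges 5 _ F (List.nodup_finRange _)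
      (by simp) (fun e he => (mem_edgeSet_g16_iff e).1 (hF e he))
      (fun _ _ _ _ => List.mem_finRange _) fun v _ => hv v
  · rintro ⟨l, hl, rfl⟩
    exact (isPerfectMatchingOf_iff mem_edgeSet_g16_iff _).2 (edgesOf_mem_g16Matchings l hl)

theorem nodup_map_maskOf_g16Matchings : (g16Matchings.map maskOf).Nodup := by
  decide +kernel

/-- The edges at the vertex `0`. -/
def g16EdgesAtZero : List (Sym2 (Fin 10)) :=
  [s(0, 1), s(0, 2), s(0, 3), s(0, 6), s(0, 8), s(0, 9)]

theorem splitSum_g16 :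
    splitSum (g16EdgesAtZero.map (weightedMasks g16Matchings)) (maskOf g16Edges) = 256 := by
  decide +kernel

theorem G16'_sign_sum_ne_zero : factorizationSignSum 6 G16' ≠ 0 := by
  have h := partitionSum_maskEdges nodup_map_maskOf_g16Matchings isPerfectMatchingOf_g16_iff 0
    g16EdgesAtZero (maskOf g16Edges) (by decide +kernel) (by decide +kernel)
    (by rw [maskEdges_maskOf]; decide +kernel)
    (fun i hi => by
      obtain ⟨e, -, he⟩ := (testBit_maskOf _ i).1 hi
      exact ⟨e, he⟩)
  rw [splitSum_g16, maskEdges_maskOf] at h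
  rw [factorizationSignSum_eq_partitionSum 6 G16' _ mem_edgeSet_g16_iff]
  change partitionSum (matchingWeight G16') 6 _ = _ at h
  rw [h]
  positivity
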